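/- arXiv:1308.4341 — 2 statements merged into one kernel-verified Lean document; each statement's English description precedes it below -/
import Mathlib

section
/- Let k ≥ 1, n > 7k², and let G be a simple graph of order n. If q(G) ≥ q(S_{n,k}^+) and G contains no path on 2k+3 vertices as a subgraph, then G has a vertex of degree n−1 (i.e., Δ(G) = n−1). -/
open Matrix BigOperators

noncomputable def edgeCount {V : Type*} (G : SimpleGraph V) : ℕ := Nat.card G.edgeSet

noncomputable def deg {V : Type*} (G : SimpleGraph V) (v : V) : ℕ := Nat.card (G.neighborSet v)

def HasPathOn {V : Type*} (G : SimpleGraph V) (l : ℕ) : Prop :=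
  ∃ (u v : V) (p : G.Walk u v), p.IsPath ∧ p.support.length = l

noncomputable def signlessLaplacian {V : Type*} [Fintype V] [DecidableEq V]
    (G : SimpleGraph V) : Matrix V V ℝ :=
  letI : DecidableRel G.Adj := Classical.decRel _
  Matrix.diagonal (fun v => (deg G v : ℝ)) + G.adjMatrix ℝ

theorem signlessLaplacian_isHermitian {V : Type*} [Fintype V] [DecidableEq V]
    (G : SimpleGraph V) : (signlessLaplacian G).IsHermitian := by
  letI : DecidableRel G.Adj := Classical.decRel _
  unfold signlessLaplacian
  refine (Matrix.isHermitian_diagonal _).add ?_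
  rw [Matrix.IsHermitian, Matrix.conjTranspose_eq_transpose_of_trivial]
  exact G.isSymm_adjMatrix

/-- The `Q`-index of a graph: the largest eigenvalue of its signless Laplacian. -/
noncomputable def qIndex {V : Type*} [Fintype V] [DecidableEq V] (G : SimpleGraph V) : ℝ :=
  ⨆ v, (signlessLaplacian_isHermitian G).eigenvalues v

noncomputable def adjMat {V : Type*} [Fintype V] (G : SimpleGraph V) : Matrix V V ℝ :=
  letI : DecidableRel G.Adj := Classical.decRel _
  G.adjMatrix ℝ

theorem adjMat_isHermitian {V : Type*} [Fintype V] (G : SimpleGraph V) :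
    (adjMat G).IsHermitian := by
  letI : DecidableRel G.Adj := Classical.decRel _
  unfold adjMat
  rw [Matrix.IsHermitian, Matrix.conjTranspose_eq_transpose_of_trivial]
  exact G.isSymm_adjMatrix

/-- The spectral radius `μ`: the largest eigenvalue of the adjacency matrix. -/
noncomputable def muIndex {V : Type*} [Fintype V] [DecidableEq V] (G : SimpleGraph V) : ℝ :=
  ⨆ v, (adjMat_isHermitian G).eigenvalues v

/-- `S_{n,k} = K_k ∨ \overline{K_{n-k}}`: the first `k` vertices form a clique joined to all. -/
def Snk (n k : ℕ) : SimpleGraph (Fin n) :=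
  SimpleGraph.fromRel (fun i j => (i : ℕ) < k ∨ (j : ℕ) < k)

/-- `S_{n,k}^+`: `S_{n,k}` plus one edge inside the independent set. -/
def SnkPlus (n k : ℕ) : SimpleGraph (Fin n) :=
  SimpleGraph.fromRel (fun i j => (i : ℕ) < k ∨ (j : ℕ) < k ∨ ((i : ℕ) = k ∧ (j : ℕ) = k + 1))

/-- `L_{t,k} = K_1 ∨ tK_k`: `t` cliques of order `k+1` sharing a common center `none`. -/
def LGraph (t k : ℕ) : SimpleGraph (Option (Fin t × Fin k)) :=
  SimpleGraph.fromRel (fun x y => x = none ∨ ∃ i a b, x = some (i, a) ∧ y = some (i, b))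

/-- `K_1 ∨ (sK_k ∪ K_m)`. -/
def K1JoinCliques (s k m : ℕ) : SimpleGraph (Option ((Fin s × Fin k) ⊕ Fin m)) :=
  SimpleGraph.fromRel (fun x y => x = none ∨
    (∃ i a b, x = some (Sum.inl (i, a)) ∧ y = some (Sum.inl (i, b))) ∨
    (∃ a b, x = some (Sum.inr a) ∧ y = some (Sum.inr b)))

/-- Two disjoint copies of `L_{s,k}` and `L_{t,k}` with their centers joined by an edge. -/
def DoubleL (s t k : ℕ) : SimpleGraph (Option (Fin s × Fin k) ⊕ Option (Fin t × Fin k)) :=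
  SimpleGraph.fromRel (fun x y =>
    (∃ a b, x = Sum.inl a ∧ y = Sum.inl b ∧ (LGraph s k).Adj a b) ∨
    (∃ a b, x = Sum.inr a ∧ y = Sum.inr b ∧ (LGraph t k).Adj a b) ∨
    (x = Sum.inl none ∧ y = Sum.inr none))

/-- `G` is (a copy of) a subgraph of `H`. -/
def IsSubgraphOf {V W : Type*} (G : SimpleGraph V) (H : SimpleGraph W) : Prop :=
  ∃ f : V ↪ W, ∀ a b, G.Adj a b → H.Adj (f a) (f b)

/-- `G` contains `m` pairwise disjoint edges. -/
def HasMatching {V : Type*} (G : SimpleGraph V) (m : ℕ) : Prop :=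
  ∃ M : Finset (Sym2 V), M.card = m ∧ (∀ e ∈ M, e ∈ G.edgeSet) ∧
    ∀ e ∈ M, ∀ f ∈ M, e ≠ f → ∀ v : V, ¬(v ∈ e ∧ v ∈ f)

/-- `G` is 2-connected: at least 3 vertices, and deleting any vertex leaves a connected graph. -/
def TwoConnected {V : Type*} [Fintype V] (G : SimpleGraph V) : Prop :=
  3 ≤ Fintype.card V ∧ ∀ v : V, (G.induce {w : V | w ≠ v}).Connected

open scoped Classical in
theorem deg_eq_degree {V : Type*} [Fintype V] (G : SimpleGraph V) (v : V) :
    deg G v = G.degree v := by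
  rw [deg, Nat.card_eq_fintype_card, SimpleGraph.card_neighborSet_eq_degree]

theorem Matrix.IsHermitian.dotProduct_mulVec_le_iSup_eigenvalues {V : Type*} [Fintype V]
    [DecidableEq V] {A : Matrix V V ℝ} (hA : A.IsHermitian) (x : V → ℝ) :
    x ⬝ᵥ A *ᵥ x ≤ (⨆ i, hA.eigenvalues i) * (x ⬝ᵥ x) := by
  have hexp (y z : V → ℝ) : y ⬝ᵥ z =
      ∑ i, (y ⬝ᵥ ⇑(hA.eigenvectorBasis i)) * (⇑(hA.eigenvectorBasis i) ⬝ᵥ z) := by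
    have h := hA.eigenvectorBasis.sum_inner_mul_inner (WithLp.toLp 2 y) (WithLp.toLp 2 z)
    simp only [EuclideanSpace.inner_eq_star_dotProduct, star_trivial] at h
    rw [dotProduct_comm y z, ← h]
    exact Finset.sum_congr rfl fun i _ => by
      rw [dotProduct_comm y, dotProduct_comm z]
  have hsymm : ∀ i, ⇑(hA.eigenvectorBasis i) ⬝ᵥ A *ᵥ x =
      hA.eigenvalues i * (x ⬝ᵥ ⇑(hA.eigenvectorBasis i)) := fun i => by
    have hT : Aᵀ = A := by simpa [Matrix.IsHermitian] using hA
    rw [dotProduct_mulVec, ← mulVec_transpose, hT, hA.mulVec_eigenvectorBasis, smul_dotProduct,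
      smul_eq_mul, dotProduct_comm]
  rw [hexp x (A *ᵥ x), hexp x x, Finset.mul_sum]
  refine Finset.sum_le_sum fun i _ => ?_
  have hle : hA.eigenvalues i ≤ ⨆ i, hA.eigenvalues i :=
    le_ciSup (Set.finite_range _).bddAbove i
  rw [hsymm, dotProduct_comm _ x]
  nlinarith [mul_self_nonneg (x ⬝ᵥ ⇑(hA.eigenvectorBasis i))]

theorem le_qIndex_of_le_mulVec {V : Type*} [Fintype V] [DecidableEq V] (G : SimpleGraph V)
    {x : V → ℝ} {c : ℝ} (hx : ∀ v, 0 ≤ x v) (hx0 : x ≠ 0)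
    (h : ∀ v, c * x v ≤ (signlessLaplacian G *ᵥ x) v) : c ≤ qIndex G := by
  have hpos : 0 < x ⬝ᵥ x := by
    refine lt_of_le_of_ne (Finset.sum_nonneg fun v _ => mul_self_nonneg _) fun h0 => hx0 ?_
    exact dotProduct_self_eq_zero.1 h0.symm
  refine le_of_mul_le_mul_right (le_trans ?_
    ((signlessLaplacian_isHermitian G).dotProduct_mulVec_le_iSup_eigenvalues x)) hpos
  rw [dotProduct, dotProduct, Finset.mul_sum]
  refine Finset.sum_le_sum fun v _ => ?_
  nlinarith [mul_le_mul_of_nonneg_left (h v) (hx v)]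

open scoped Classical in
theorem signlessLaplacian_mulVec_apply {V : Type*} [Fintype V] [DecidableEq V]
    (G : SimpleGraph V) (x : V → ℝ) (v : V) :
    (signlessLaplacian G *ᵥ x) v = ∑ w, if G.Adj v w then x v + x w else 0 := by
  have hdeg : (deg G v : ℝ) = ∑ w, if G.Adj v w then (1 : ℝ) else 0 := by
    rw [deg_eq_degree, ← SimpleGraph.card_neighborFinset_eq_degree, Finset.sum_boole]
    congr 2
    ext; simp
  rw [signlessLaplacian, add_mulVec, Pi.add_apply, mulVec_diagonal, hdeg, mulVec, dotProduct,
    Finset.sum_mul, ← Finset.sum_add_distrib]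
  exact Finset.sum_congr rfl fun w _ => by
    rw [SimpleGraph.adjMatrix_apply]
    by_cases h : G.Adj v w <;> simp [h]

open scoped Classical in
theorem exists_qIndex_mul_degree_le {V : Type*} [Fintype V] [DecidableEq V] [Nonempty V]
    (G : SimpleGraph V) (hq : 0 < qIndex G) :
    ∃ u, 0 < G.degree u ∧ qIndex G * G.degree u ≤
      (G.degree u : ℝ) ^ 2 + ∑ v ∈ G.neighborFinset u, (G.degree v : ℝ) := by
  have hH := signlessLaplacian_isHermitian G
  obtain ⟨i, hi⟩ := exists_eq_ciSup_of_finite (f := hH.eigenvalues)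
  replace hi : hH.eigenvalues i = qIndex G := hi
  set x : V → ℝ := ⇑(hH.eigenvectorBasis i) with hx
  have hmul (v : V) : qIndex G * x v = ∑ w ∈ G.neighborFinset v, (x v + x w) := by
    have h := congrFun (hH.mulVec_eigenvectorBasis i) v
    rw [signlessLaplacian_mulVec_apply, hi, Pi.smul_apply, smul_eq_mul] at h
    rw [← hx] at h
    rw [← h, ← Finset.sum_filter]
    exact Finset.sum_congr (by ext; simp) fun _ _ => rfl
  have hx0 : ∃ v, x v ≠ 0 := by
    by_contra! h
    have : hH.eigenvectorBasis i = 0 := by ext v; exact h v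
    exact hH.eigenvectorBasis.orthonormal.ne_zero i this
  have hzero (v : V) (hv : G.degree v = 0) : x v = 0 := by
    have h := hmul v
    rw [← SimpleGraph.card_neighborFinset_eq_degree, Finset.card_eq_zero] at hv
    rw [hv, Finset.sum_empty] at h
    exact (mul_eq_zero.1 h).resolve_left hq.ne'
  obtain ⟨u, -, hu⟩ := Finset.exists_max_image Finset.univ
    (fun v => |x v| / G.degree v) Finset.univ_nonempty
  set M := |x u| / G.degree u with hM
  have hxM (v : V) : |x v| ≤ G.degree v * M := by
    rcases Nat.eq_zero_or_pos (G.degree v) with h | h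
    · simp [hzero v h, h]
    · have := hu v (Finset.mem_univ v)
      rwa [div_le_iff₀' (by exact_mod_cast h)] at this
  have hMpos : 0 < M := by
    obtain ⟨v, hv⟩ := hx0
    have := hxM v
    by_contra! h
    nlinarith [abs_pos.2 hv,
      mul_nonpos_of_nonneg_of_nonpos (Nat.cast_nonneg (α := ℝ) (G.degree v)) h]
  have hdu : 0 < G.degree u := by
    rcases Nat.eq_zero_or_pos (G.degree u) with h | h
    · simp [hM, h] at hMpos
    · exact h
  refine ⟨u, hdu, le_of_mul_le_mul_right ?_ hMpos⟩
  have hxu : |x u| = G.degree u * M := by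
    rw [hM]; field_simp
  calc qIndex G * G.degree u * M = |qIndex G * x u| := by
        rw [abs_mul, abs_of_pos hq, hxu]; ring
    _ ≤ ∑ w ∈ G.neighborFinset u, (G.degree u * M + G.degree w * M) := by
        rw [hmul]
        refine (Finset.abs_sum_le_sum_abs _ _).trans (Finset.sum_le_sum fun w _ => ?_)
        exact (abs_add_le _ _).trans (add_le_add (hxM u) (hxM w))
    _ = _ := by
        rw [Finset.sum_add_distrib, Finset.sum_const, SimpleGraph.card_neighborFinset_eq_degree,
          nsmul_eq_mul, add_mul, Finset.sum_mul]
        ring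

theorem sub_le_qIndex_SnkPlus {n k : ℕ} (hk : 1 ≤ k) (hkn : k < n) {ε : ℝ}
    (hεn : ε ≤ n - 2) (hε : 2 * k * (k - 1 : ℝ) ≤ ε * (n + 2 * k - 2 - ε)) :
    n + 2 * k - 2 - ε ≤ qIndex (SnkPlus n k) := by
  classical
  set c : ℝ := n + 2 * k - 2 - ε with hc
  have hk0 : (1 : ℝ) ≤ k := by exact_mod_cast hk
  set a : ℝ := (c - k) / k with ha
  have hka : k * a = c - k := by rw [ha]; field_simp
  have ha0 : 0 ≤ a := div_nonneg (by linarith) (by linarith)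
  have hcard : (Finset.univ.filter fun j : Fin n => (j : ℕ) < k).card = k := by
    rw [Fin.card_filter_val_lt, min_eq_right hkn.le]
  set x : Fin n → ℝ := fun i => if (i : ℕ) < k then a else 1 with hx
  have hx0 (i : Fin n) : 0 ≤ x i := by simp only [hx]; split_ifs <;> linarith
  refine le_qIndex_of_le_mulVec _ hx0 (fun h => ?_) fun i => ?_
  · have := congrFun h ⟨k, hkn⟩
    simp [hx] at this
  rw [signlessLaplacian_mulVec_apply]
  by_cases hi : (i : ℕ) < k
  · have hxi : x i = a := by simp [hx, hi]
    have hsumx : ∑ j, x j = k * a + (n - k) := by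
      have h1 (j : Fin n) : x j = (if (j : ℕ) < k then a - 1 else 0) + 1 := by
        simp only [hx]; split_ifs <;> ring
      simp only [h1, Finset.sum_add_distrib, ← Finset.sum_filter, Finset.sum_const, hcard]
      simp
      ring
    have hsum : (∑ j, if (SnkPlus n k).Adj i j then x i + x j else 0)
        = n * a + ∑ j, x j - 2 * a := by
      have h1 (j : Fin n) : (if (SnkPlus n k).Adj i j then x i + x j else 0)
          = (a + x j) - if j = i then 2 * a else 0 := by
        rcases eq_or_ne j i with rfl | hj
        · simp [hxi]; ring
        · simp [SnkPlus, hi, hj, hj.symm, hxi]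
      simp only [h1, Finset.sum_sub_distrib, Finset.sum_add_distrib]
      simp
    rw [hsum, hsumx, hxi]
    refine le_of_mul_le_mul_left ?_ (by linarith : (0 : ℝ) < k)
    nlinarith
  · have hxi : x i = 1 := by simp [hx, hi]
    have hsum : ∑ j : Fin n, (if (j : ℕ) < k then 1 + a else 0) = c := by
      rw [← Finset.sum_filter, Finset.sum_const, hcard, nsmul_eq_mul]
      linarith
    rw [hxi, mul_one, ← hsum]
    refine Finset.sum_le_sum fun j _ => ?_
    by_cases hj : (j : ℕ) < k
    · have hij : i ≠ j := by rintro rfl; exact hi hj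
      have hxj : x j = a := by simp [hx, hj]
      simp [SnkPlus, hj, hij, hxj]
    · have := hx0 j
      rw [if_neg hj]
      split_ifs <;> linarith

namespace SimpleGraph

variable {V : Type*} {G : SimpleGraph V}

/-- The list `l` enumerates the vertices of a path of `G` of maximum order. -/
structure IsLongestPath (G : SimpleGraph V) (l : List V) : Prop where
  isChain : l.IsChain G.Adj
  nodup : l.Nodup
  length_le : ∀ l' : List V, l'.IsChain G.Adj → l'.Nodup → l'.length ≤ l.length

theorem exists_isLongestPath [Fintype V] (G : SimpleGraph V) : ∃ l, G.IsLongestPath l := by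
  classical
  let P : ℕ → Prop := fun m => ∃ l : List V, l.IsChain G.Adj ∧ l.Nodup ∧ l.length = m
  have h0 : P 0 := ⟨[], by simp, by simp, rfl⟩
  obtain ⟨l, hl, hnd, hlen⟩ : P (Nat.findGreatest P (Fintype.card V)) :=
    Nat.findGreatest_spec (Nat.zero_le _) h0
  exact ⟨l, hl, hnd, fun l' hl' hnd' => hlen ▸
    Nat.le_findGreatest hnd'.length_le_card ⟨l', hl', hnd', rfl⟩⟩

namespace IsLongestPath

theorem reverse {l : List V} (h : G.IsLongestPath l) : G.IsLongestPath l.reverse where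
  isChain := by
    rw [List.isChain_reverse]
    exact h.isChain.imp fun _ _ hab => hab.symm
  nodup := List.nodup_reverse.2 h.nodup
  length_le := by simpa using h.length_le

theorem ne_nil [Nonempty V] {l : List V} (h : G.IsLongestPath l) : l ≠ [] := by
  rintro rfl
  have := h.length_le [Classical.arbitrary V] (by simp) (by simp)
  simp at this

theorem mem_of_adj_head {x y : V} {t : List V} (h : G.IsLongestPath (x :: t)) (hxy : G.Adj x y) :
    y ∈ t := by
  by_contra hy
  have := h.length_le (y :: x :: t) (List.isChain_cons_cons.2 ⟨hxy.symm, h.isChain⟩)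
    (List.nodup_cons.2 ⟨by simp [hxy.ne', hy], h.nodup⟩)
  simp at this

/-- In a connected graph, a longest path whose ends are adjacent is a Hamiltonian path. -/
theorem mem_of_adj_ends (hG : G.Preconnected) {l : List V} (h : G.IsLongestPath l) (hl : l ≠ [])
    (hends : G.Adj (l.getLast hl) (l.head hl)) (y : V) : y ∈ l := by
  suffices hclosed : ∀ z w, G.Adj z w → z ∈ l → w ∈ l by
    obtain ⟨p⟩ := hG (l.head hl) y
    have key : ∀ {a b : V}, G.Walk a b → a ∈ l → b ∈ l := by
      intro a b p
      induction p with
      | nil => exact id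
      | cons hadj _ ih => exact fun ha => ih (hclosed _ _ hadj ha)
    exact key p (List.head_mem hl)
  intro z w hzw hz
  by_contra hw
  obtain ⟨s, t, rfl⟩ := List.append_of_mem hz
  have hch := h.isChain
  rw [List.isChain_append] at hch
  have hnd : ((z :: t) ++ s).Nodup := List.nodup_append_comm.1 h.nodup
  have hrot : ((z :: t) ++ s).IsChain G.Adj := by
    rw [List.isChain_append]
    refine ⟨hch.2.1, hch.1, fun a ha b hb => ?_⟩
    have hs : s ≠ [] := by rintro rfl; simp at hb
    rw [List.getLast_append_of_ne_nil _ (by simp), List.head_append_of_ne_nil hs] at hends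
    rw [List.getLast?_eq_getLast_of_ne_nil (by simp), Option.mem_some_iff] at ha
    rw [List.head?_eq_some_head hs, Option.mem_some_iff] at hb
    rw [← ha, ← hb]
    exact hends
  have := h.length_le (w :: ((z :: t) ++ s)) (List.isChain_cons_cons.2 ⟨hzw.symm, hrot⟩)
    (List.nodup_cons.2 ⟨by simp at hw ⊢; tauto, hnd⟩)
  simp at this
  omega

/-- In a connected graph, crossing chords from the ends of a longest path force it to be
Hamiltonian. -/
theorem mem_of_crossing (hG : G.Preconnected) {l : List V} (h : G.IsLongestPath l) {i : ℕ}
    (hi : i + 1 < l.length) (h1 : G.Adj l[0] l[i + 1]) (h2 : G.Adj l[i] l[l.length - 1]) (y : V) :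
    y ∈ l := by
  have hperm : (l.take (i + 1) ++ (l.drop (i + 1)).reverse).Perm l :=
    ((List.reverse_perm _).append_left _).trans (by rw [List.take_append_drop])
  have hne : l.take (i + 1) ++ (l.drop (i + 1)).reverse ≠ [] := by
    intro h0
    have := hperm.length_eq
    rw [h0] at this
    simp at this
    omega
  have hlong : G.IsLongestPath (l.take (i + 1) ++ (l.drop (i + 1)).reverse) := by
    refine ⟨?_, hperm.nodup_iff.2 h.nodup, by rw [hperm.length_eq]; exact h.length_le⟩
    have hsymm : ((l.drop (i + 1)).reverse).IsChain G.Adj := by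
      rw [List.isChain_reverse]
      exact (h.isChain.drop _).imp fun _ _ hab => hab.symm
    rw [List.isChain_append]
    refine ⟨h.isChain.take _, hsymm, fun a ha b hb => ?_⟩
    have ha' : a = l[i] := by
      rw [List.getLast?_eq_getElem?] at ha
      simp at ha
      grind
    have hb' : b = l[l.length - 1] := by
      rw [List.head?_reverse, List.getLast?_eq_getElem?] at hb
      grind
    rw [ha', hb']
    exact h2
  rw [← hperm.mem_iff]
  refine hlong.mem_of_adj_ends hG hne ?_ y
  have e1 : (l.take (i + 1) ++ (l.drop (i + 1)).reverse).head hne = l[0] := by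
    grind
  have e2 : (l.take (i + 1) ++ (l.drop (i + 1)).reverse).getLast hne = l[i + 1] := by
    grind
  rw [e1, e2]
  exact h1.symm

open scoped Classical in
theorem degree_ends_lt [Fintype V] (hG : G.Preconnected) {l : List V} (h : G.IsLongestPath l)
    (hl : 0 < l.length) (hlt : l.length < Fintype.card V) :
    G.degree l[0] + G.degree l[l.length - 1] < l.length := by
  obtain ⟨y, hy⟩ : ∃ y, y ∉ l := by
    by_contra! hall
    have : Fintype.card V ≤ l.toFinset.card :=
      Finset.card_le_card fun y _ => List.mem_toFinset.2 (hall y)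
    have := l.toFinset_card_le
    omega
  have hhead (z : V) (hz : G.Adj l[0] z) : ∃ j, ∃ hj : j + 1 < l.length, l[j + 1] = z := by
    obtain ⟨x, t, rfl⟩ := List.exists_cons_of_length_pos hl
    obtain ⟨j, hj, hjz⟩ := List.getElem_of_mem (h.mem_of_adj_head hz)
    exact ⟨j, by simpa using hj, by simpa using hjz⟩
  have hlast (z : V) (hz : G.Adj l[l.length - 1] z) : ∃ j, ∃ hj : j + 1 < l.length, l[j] = z := by
    have hr := h.reverse
    obtain ⟨x, t, hxt⟩ := List.exists_cons_of_length_pos (l := l.reverse) (by simpa using hl)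
    rw [hxt] at hr
    have hx : x = l[l.length - 1] := by
      have : l.reverse[0]'(by simpa using hl) = x := by simp [hxt]
      rw [← this, List.getElem_reverse]
      simp only [Nat.sub_zero]
    obtain ⟨j, hj, hjz⟩ := List.getElem_of_mem (hr.mem_of_adj_head (hx ▸ hz))
    have hlen : l.length = t.length + 1 := by simpa using congrArg List.length hxt
    refine ⟨l.length - 1 - (j + 1), by omega, ?_⟩
    have : l.reverse[j + 1]'(by simp; omega) = z := by simp [hxt, hjz]
    rw [← this, List.getElem_reverse]
  set A := (Finset.range (l.length - 1)).filter fun i =>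
    ∃ hi : i + 1 < l.length, G.Adj l[0] l[i + 1] with hA
  set B := (Finset.range (l.length - 1)).filter fun i =>
    ∃ hi : i + 1 < l.length, G.Adj l[i] l[l.length - 1] with hB
  have hdA : G.degree l[0] ≤ A.card := by
    rw [← card_neighborFinset_eq_degree]
    refine Finset.card_le_card_of_surjOn (fun i => l.getD (i + 1) l[0]) fun z hz => ?_
    have hz' : G.Adj l[0] z := by simpa using hz
    obtain ⟨j, hj, rfl⟩ := hhead z hz'
    refine ⟨j, ?_, by simp [hj]⟩
    simp only [hA, Finset.coe_filter, Finset.mem_range, Set.mem_ofPred_eq]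
    exact ⟨by omega, hj, hz'⟩
  have hdB : G.degree l[l.length - 1] ≤ B.card := by
    rw [← card_neighborFinset_eq_degree]
    refine Finset.card_le_card_of_surjOn (fun i => l.getD i l[0]) fun z hz => ?_
    have hz' : G.Adj l[l.length - 1] z := by simpa using hz
    obtain ⟨j, hj, rfl⟩ := hlast z hz'
    refine ⟨j, ?_, by simp [show j < l.length by omega]⟩
    simp only [hB, Finset.coe_filter, Finset.mem_range, Set.mem_ofPred_eq]
    exact ⟨by omega, hj, hz'.symm⟩
  have hdisj : Disjoint A B := by
    refine Finset.disjoint_left.2 fun i hiA hiB => ?_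
    obtain ⟨-, hi, h1⟩ := Finset.mem_filter.1 hiA
    obtain ⟨-, _, h2⟩ := Finset.mem_filter.1 hiB
    exact hy (h.mem_of_crossing hG hi h1 h2 y)
  have hcard : (A ∪ B).card ≤ (Finset.range (l.length - 1)).card :=
    Finset.card_le_card (Finset.union_subset (Finset.filter_subset _ _) (Finset.filter_subset _ _))
  rw [Finset.card_union_of_disjoint hdisj, Finset.card_range] at hcard
  omega

end IsLongestPath

end SimpleGraph

namespace SimpleGraph

theorem IsLongestPath.connected_induce_compl_head {V : Type*} {G : SimpleGraph V} {x : V}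
    {t : List V} (hG : G.Connected) (h : G.IsLongestPath (x :: t)) (ht : t ≠ []) :
    (G.induce {x}ᶜ).Connected := by
  have hxt : x ∉ t := (List.nodup_cons.1 h.nodup).1
  have hmem (z : V) (hz : z ∈ t) : z ∈ ({x}ᶜ : Set V) := by
    rintro rfl; exact hxt hz
  let r : ({x}ᶜ : Set V) := ⟨t.head ht, hmem _ (List.head_mem ht)⟩
  have htail (z : V) (hz : z ∈ t) : (G.induce {x}ᶜ).Reachable r ⟨z, hmem z hz⟩ := by
    have hch : t.IsChain G.Adj := h.isChain.tail
    obtain ⟨j, hj, rfl⟩ := List.getElem_of_mem hz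
    induction j with
    | zero =>
      have : r = ⟨t[0], hmem _ (List.getElem_mem hj)⟩ := Subtype.ext (List.head_eq_getElem_zero _)
      rw [this]
    | succ j ih =>
      refine (ih (by omega) (List.getElem_mem _)).trans (Adj.reachable ?_)
      exact hch.getElem j hj
  have hall (y : V) : y = x ∨ ∃ hy : y ∈ ({x}ᶜ : Set V), (G.induce {x}ᶜ).Reachable r ⟨y, hy⟩ := by
    obtain ⟨p⟩ := hG.preconnected x y
    have key : ∀ {a b : V}, G.Walk a b →
        (a = x ∨ ∃ ha : a ∈ ({x}ᶜ : Set V), (G.induce {x}ᶜ).Reachable r ⟨a, ha⟩) →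
        (b = x ∨ ∃ hb : b ∈ ({x}ᶜ : Set V), (G.induce {x}ᶜ).Reachable r ⟨b, hb⟩) := by
      intro a b p
      induction p with
      | nil => exact id
      | @cons a c _ hadj _ ih =>
        refine fun ha => ih ?_
        by_cases hc : c = x
        · exact Or.inl hc
        refine Or.inr ⟨hc, ?_⟩
        rcases ha with rfl | ⟨ha, hra⟩
        · exact htail c (h.mem_of_adj_head hadj)
        · exact hra.trans (Adj.reachable hadj)
    exact key p (Or.inl rfl)
  have : Nonempty ({x}ᶜ : Set V) := ⟨r⟩
  refine ⟨fun a b => ?_⟩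
  have hr (a : ({x}ᶜ : Set V)) : (G.induce {x}ᶜ).Reachable r a := by
    rcases hall a with ha | ⟨_, ha⟩
    · exact absurd ha a.2
    · exact ha
  exact (hr a).symm.trans (hr b)

theorem length_lt_of_forall_length_ne {V : Type*} {G : SimpleGraph V} {m : ℕ}
    (hP : ∀ l : List V, l.IsChain G.Adj → l.Nodup → l.length ≠ m) {l : List V}
    (hl : l.IsChain G.Adj) (hnd : l.Nodup) : l.length < m := by
  by_contra! hm
  exact hP (l.take m) (hl.take _) (hnd.sublist (List.take_sublist _ _)) (by simp [hm])

open scoped Classical in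
theorem exists_isLongestPath_cons [Fintype V] {G : SimpleGraph V} (hG : G.Connected) {k : ℕ}
    (hP : ∀ l : List V, l.IsChain G.Adj → l.Nodup → l.length ≠ 2 * k + 3)
    (hcard : 2 * k + 3 ≤ Fintype.card V) :
    ∃ x t, G.IsLongestPath (x :: t) ∧ t ≠ [] ∧ G.degree x ≤ k := by
  have := hG.nonempty
  obtain ⟨l, hl⟩ := G.exists_isLongestPath
  have hlen : l.length < 2 * k + 3 := length_lt_of_forall_length_ne hP hl.isChain hl.nodup
  have hpos : 0 < l.length := List.length_pos_of_ne_nil hl.ne_nil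
  have hdeg := hl.degree_ends_lt hG.preconnected hpos (by omega)
  have key : ∀ l : List V, G.IsLongestPath l → ∀ h : 0 < l.length, G.degree l[0] ≤ k →
      ∃ x t, G.IsLongestPath (x :: t) ∧ t ≠ [] ∧ G.degree x ≤ k := by
    intro l hl h hd
    obtain ⟨x, t, rfl⟩ := List.exists_cons_of_length_pos h
    refine ⟨x, t, hl, ?_, hd⟩
    have : Nontrivial V := Fintype.one_lt_card_iff_nontrivial.1 (by omega)
    obtain ⟨y, hy⟩ := hG.preconnected.exists_adj_of_nontrivial x
    exact List.ne_nil_of_mem (hl.mem_of_adj_head hy)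
  rcases le_total (G.degree l[0]) (G.degree l[l.length - 1]) with hle | hle
  · exact key l hl hpos (by omega)
  · refine key l.reverse hl.reverse (by simpa using hpos) ?_
    rw [List.getElem_reverse]
    simp only [Nat.sub_zero]
    omega

open scoped Classical in
theorem card_edgeFinset_le_of_forall_length_ne (k : ℕ) {N : ℕ} (hN : 2 * k + 3 ≤ N) :
    ∀ {V : Type*} [Fintype V] {G : SimpleGraph V}, Fintype.card V = N → G.Connected →
      (∀ l : List V, l.IsChain G.Adj → l.Nodup → l.length ≠ 2 * k + 3) →
      G.edgeFinset.card ≤ k * N + k := by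
  induction N, hN using Nat.le_induction with
  | base =>
    intro V _ G hcard hG hP
    obtain ⟨x, t, hl, ht, hdeg⟩ := exists_isLongestPath_cons hG hP hcard.ge
    have hE := G.card_edgeFinset_induce_compl_singleton x
    rw [card_edgeFinset_deleteIncidenceSet] at hE
    have hlen := length_lt_of_forall_length_ne hP hl.isChain hl.nodup
    obtain ⟨y, hy⟩ : ∃ y, y ∉ x :: t := by
      by_contra! hall
      have : Fintype.card V ≤ (x :: t).toFinset.card :=
        Finset.card_le_card fun y _ => List.mem_toFinset.2 (hall y)
      have := (x :: t).toFinset_card_le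
      omega
    have hyx : y ≠ x := by rintro rfl; simp at hy
    have hyt : y ∉ t := fun h => hy (List.mem_cons_of_mem _ h)
    have hz : t.getLast ht ∈ t := List.getLast_mem ht
    have hzx : t.getLast ht ≠ x := fun h => (List.nodup_cons.1 hl.nodup).1 (h ▸ hz)
    have hzy : ¬ G.Adj (t.getLast ht) y := by
      intro hadj
      have hr := hl.reverse
      rw [show (x :: t).reverse = t.getLast ht :: (t.dropLast.reverse ++ [x]) by
        conv_lhs => rw [← List.dropLast_append_getLast ht]
        simp] at hr
      have := hr.mem_of_adj_head hadj
      simp only [List.mem_append, List.mem_reverse, List.mem_singleton] at this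
      exact this.elim (fun h => hyt (List.mem_of_mem_dropLast h)) hyx
    have hlt : (G.induce {x}ᶜ).edgeFinset.card < (2 * k + 2).choose 2 := by
      have hc : Fintype.card ({x}ᶜ : Set V) = 2 * k + 2 := by
        rw [Fintype.card_compl_set, hcard, Fintype.card_unique]
        omega
      rw [← hc, ← card_edgeFinset_top_eq_card_choose_two]
      refine Finset.card_lt_card (Finset.ssubset_iff_of_subset
        (edgeFinset_mono le_top) |>.2 ⟨s(⟨t.getLast ht, hzx⟩, ⟨y, hyx⟩), ?_, ?_⟩)
      · rw [mem_edgeFinset, mem_edgeSet, top_adj]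
        intro h
        have h' : t.getLast ht = y := congrArg Subtype.val h
        exact hyt (h' ▸ hz)
      · rw [mem_edgeFinset, mem_edgeSet]
        exact hzy
    rw [Nat.choose_two_right, show (2 * k + 2) * (2 * k + 2 - 1) = ((k + 1) * (2 * k + 1)) * 2 by
      rw [show 2 * k + 2 - 1 = 2 * k + 1 by omega]; ring, Nat.mul_div_cancel _ two_pos] at hlt
    have : G.edgeFinset.card < (k + 1) * (2 * k + 1) + k := by omega
    nlinarith
  | succ N hN ih =>
    intro V _ G hcard hG hP
    obtain ⟨x, t, hl, ht, hdeg⟩ := exists_isLongestPath_cons hG hP (by omega)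
    have hE := G.card_edgeFinset_induce_compl_singleton x
    rw [card_edgeFinset_deleteIncidenceSet] at hE
    have hc : Fintype.card ({x}ᶜ : Set V) = N := by
      rw [Fintype.card_compl_set, hcard, Fintype.card_unique]
      omega
    have hH := ih hc (hl.connected_induce_compl_head hG ht) fun l hch hnd hlen => by
      refine hP (l.map Subtype.val) ?_ (hnd.map Subtype.val_injective) (by simpa using hlen)
      rw [List.isChain_map]
      exact hch
    have hH' : (G.induce {x}ᶜ).edgeFinset.card ≤ k * N + k := by convert hH
    have h2 : G.edgeFinset.card ≤ k * N + k + k := by omega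
    linarith

open scoped Classical in
theorem sum_degree_neighborFinset_add_card_le [Fintype V] {G : SimpleGraph V}
    (hG : G.Connected) (u : V) :
    ∑ v ∈ G.neighborFinset u, G.degree v + Fintype.card V ≤ 2 * G.edgeFinset.card + 1 := by
  rcases subsingleton_or_nontrivial V with hV | hV
  · have : Fintype.card V ≤ 1 := Fintype.card_le_one_iff_subsingleton.2 hV
    have h0 : G.neighborFinset u = ∅ := by
      ext v
      simp [Subsingleton.elim v u]
    rw [h0, Finset.sum_empty]
    omega
  have hpos (v : V) : 0 < G.degree v := hG.preconnected.degree_pos_of_nontrivial v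
  rw [← G.sum_degrees_eq_twice_card_edges, ← Finset.sum_add_sum_compl (G.neighborFinset u)]
  have hu : u ∈ (G.neighborFinset u)ᶜ := by simp
  rw [← Finset.add_sum_erase _ _ hu]
  have h1 : ((G.neighborFinset u)ᶜ.erase u).card ≤
      ∑ v ∈ (G.neighborFinset u)ᶜ.erase u, G.degree v := by
    rw [Finset.card_eq_sum_ones]
    exact Finset.sum_le_sum fun v _ => hpos v
  rw [Finset.card_erase_of_mem hu, Finset.card_compl, card_neighborFinset_eq_degree] at h1
  omega

open scoped Classical in
theorem sum_degree_neighborFinset_add_le [Fintype V] {G : SimpleGraph V} {k n : ℕ} (hk : 1 ≤ k)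
    (hn : 7 * k ^ 2 < n) (hVn : Fintype.card V ≤ n) (hG : G.Connected)
    (hP : ∀ l : List V, l.IsChain G.Adj → l.Nodup → l.length ≠ 2 * k + 3) (u : V) :
    ∑ v ∈ G.neighborFinset u, G.degree v + n ≤ 2 * k * n + 2 * k + 1 := by
  rcases le_or_gt (2 * k + 3) (Fintype.card V) with hc | hc
  · have h1 := card_edgeFinset_le_of_forall_length_ne k hc rfl hG hP
    have h2 := sum_degree_neighborFinset_add_card_le hG u
    obtain ⟨m, rfl⟩ := Nat.exists_eq_add_of_le hVn
    nlinarith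
  · have hd (v : V) : G.degree v ≤ 2 * k + 1 := by
      have := G.degree_lt_card_verts v
      omega
    have h1 : ∑ v ∈ G.neighborFinset u, G.degree v ≤ (2 * k + 1) * (2 * k + 1) := by
      refine (Finset.sum_le_card_nsmul _ _ _ fun v _ => hd v).trans ?_
      rw [card_neighborFinset_eq_degree, smul_eq_mul]
      exact Nat.mul_le_mul_right _ (hd u)
    have h2 : (2 * k - 1) * (7 * k ^ 2 + 1) ≤ (2 * k - 1) * n := Nat.mul_le_mul_left _ hn
    obtain ⟨j, rfl⟩ := Nat.exists_eq_add_of_le hk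
    rw [show 2 * (1 + j) - 1 = 2 * j + 1 by omega] at h2
    nlinarith [Nat.zero_le (j ^ 3), Nat.zero_le (j ^ 2)]

open scoped Classical in
theorem sum_degree_neighborFinset_add_le_of_forall_length_ne [Fintype V] {G : SimpleGraph V}
    {k n : ℕ} (hk : 1 ≤ k) (hn : 7 * k ^ 2 < n) (hVn : Fintype.card V ≤ n)
    (hP : ∀ l : List V, l.IsChain G.Adj → l.Nodup → l.length ≠ 2 * k + 3) (u : V) :
    ∑ v ∈ G.neighborFinset u, G.degree v + n ≤ 2 * k * n + 2 * k + 1 := by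
  set s := (G.connectedComponentMk u).supp with hs
  have hnb (v : s) : G.neighborSet v ⊆ s := fun w hw =>
    (G.connectedComponentMk u).mem_supp_of_adj_mem_supp v.2 hw
  have hu : u ∈ s := rfl
  have hconn : (G.induce s).Connected := (G.connectedComponentMk u).connected_toSimpleGraph
  have h := sum_degree_neighborFinset_add_le hk hn
    ((Fintype.card_subtype_le _).trans hVn) hconn (fun l hch hnd hlen => by
      refine hP (l.map Subtype.val) ?_ (hnd.map Subtype.val_injective) (by simpa using hlen)
      rw [List.isChain_map]
      exact hch) ⟨u, hu⟩
  rw [← map_neighborFinset_induce_of_neighborSet_subset (v := ⟨u, hu⟩) (hnb ⟨u, hu⟩),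
    Finset.sum_map]
  convert h using 2
  refine Finset.sum_congr (by congr) fun v _ => ?_
  exact (degree_induce_of_neighborSet_subset (hnb v)).symm.trans (by congr)

end SimpleGraph

/-- If `k ≥ 1`, `n > 7k²`, `q(G) ≥ q(S_{n,k}^+)` and `G` has no path on `2k+3`
vertices, then `G` has a dominating vertex, i.e. `Δ(G) = n - 1`. -/
theorem stmt_4 (k n : ℕ) (hk : 1 ≤ k) (hn : 7 * k ^ 2 < n) (G : SimpleGraph (Fin n))
    (hq : qIndex (SnkPlus n k) ≤ qIndex G) (hP : ¬ HasPathOn G (2 * k + 3)) :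
    ∃ u : Fin n, deg G u = n - 1 := by
  classical
  by_contra! hΔ
  have hkR : (1 : ℝ) ≤ k := by exact_mod_cast hk
  have hnR : 7 * (k : ℝ) ^ 2 + 1 ≤ n := by exact_mod_cast hn
  have hkn : k < n := by nlinarith
  have : Nonempty (Fin n) := ⟨⟨k, hkn⟩⟩
  have hP' : ∀ l : List (Fin n), l.IsChain G.Adj → l.Nodup → l.length ≠ 2 * k + 3 := by
    intro l hch hnd hlen
    have hne : l ≠ [] := by rintro rfl; simp at hlen
    refine hP ⟨_, _, SimpleGraph.Walk.ofSupport l hne hch, ?_, ?_⟩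
    · rw [SimpleGraph.Walk.isPath_def, SimpleGraph.Walk.support_ofSupport]
      exact hnd
    · rw [SimpleGraph.Walk.support_ofSupport, hlen]
  have hs : (0 : ℝ) < n + 2 * k - 3 := by nlinarith
  set ε : ℝ := 2 * k * (k - 1) / (n + 2 * k - 3) with hε
  have hεs : ε * (n + 2 * k - 3) = 2 * k * (k - 1) := by rw [hε]; field_simp
  have hε0 : 0 ≤ ε := div_nonneg (by nlinarith) hs.le
  have hε1 : 7 * ε < 2 := by
    rw [hε, mul_div_assoc', div_lt_iff₀ hs]
    nlinarith
  have hq' := (sub_le_qIndex_SnkPlus hk hkn (ε := ε) (by nlinarith) (by nlinarith)).trans hq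
  obtain ⟨u, hu0, hu⟩ := exists_qIndex_mul_degree_le G (by nlinarith)
  have hd (v : Fin n) : G.degree v + 2 ≤ n := by
    have h1 := hΔ v
    rw [deg_eq_degree] at h1
    have h2 := G.degree_lt_card_verts v
    rw [Fintype.card_fin] at h2
    omega
  have hdR (v : Fin n) : (G.degree v : ℝ) + 2 ≤ n := by exact_mod_cast hd v
  have hu0R : (0 : ℝ) < G.degree u := by exact_mod_cast hu0
  have hT : (∑ v ∈ G.neighborFinset u, (G.degree v : ℝ)) + n ≤ 2 * k * n + 2 * k + 1 := by
    exact_mod_cast G.sum_degree_neighborFinset_add_le_of_forall_length_ne hk hn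
      (by simp) hP' u
  have hT' : ∑ v ∈ G.neighborFinset u, (G.degree v : ℝ) ≤ G.degree u * (n - 2) := by
    refine (Finset.sum_le_card_nsmul _ _ ((n : ℝ) - 2) fun v _ => ?_).trans ?_
    · linarith [hdR v]
    · rw [SimpleGraph.card_neighborFinset_eq_degree, nsmul_eq_mul]
  set d : ℝ := (G.degree u : ℝ) with hdef
  have hqd : (n + 2 * k - 2 - ε) * d ≤ qIndex G * d := mul_le_mul_of_nonneg_right hq' hu0R.le
  have hd2k : 2 * (k : ℝ) ≤ d := by
    have h1 : 2 * k - ε ≤ d := by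
      refine le_of_mul_le_mul_right ?_ hu0R
      nlinarith
    have h2 : 2 * k < G.degree u + 1 := by
      have : (2 * k : ℝ) < G.degree u + 1 := by linarith
      exact_mod_cast this
    rw [hdef]
    exact_mod_cast Nat.lt_succ_iff.1 h2
  have hmain : d * (n + 2 * k - 2 - ε - d) + n ≤ 2 * k * n + 2 * k + 1 := by nlinarith
  have hconcave : 0 ≤ (d - 2 * k) * (n - 2 - d) :=
    mul_nonneg (by linarith) (by linarith [hdR u])
  have hεd : ε * d ≤ 2 * k * (k - 1) := by
    rw [← hεs]
    exact mul_le_mul_of_nonneg_left (by linarith [hdR u]) hε0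
  nlinarith
end

section
/- Let k ≥ 2, n ≥ 7k², and let G be a simple graph of order n with e(G) > k(n−k) and minimum degree δ(G) ≤ k−1. Suppose G has a vertex u of degree n−1 and G contains no path on 2k+3 vertices as a subgraph. Then there exists an induced subgraph H of G with at least n−k² vertices, minimum degree δ(H) ≥ k, and u ∈ V(H). -/
open Matrix BigOperators

section PathLemmas

variable {V : Type*}

open Classical in
/-- The number of neighbours of `v` inside the vertex set `t`. -/
noncomputable def degIn (G : SimpleGraph V) (t : Finset V) (v : V) : ℕ :=
  (t.filter (G.Adj v)).card

/-- Twice the number of edges induced by the vertex set `t`. -/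
noncomputable def degSum (G : SimpleGraph V) (t : Finset V) : ℕ := ∑ v ∈ t, degIn G t v

/-- The list `l` enumerates the vertices of a path of `G` lying in `t`. -/
structure IsPathIn (G : SimpleGraph V) (t : Finset V) (l : List V) : Prop where
  chain : l.IsChain G.Adj
  nodup : l.Nodup
  mem : ∀ x ∈ l, x ∈ t

theorem IsPathIn.cons {G : SimpleGraph V} {t : Finset V} {l : List V} (hl : IsPathIn G t l)
    {y : V} (hy : y ∈ t) (hyl : y ∉ l) (h : ∀ x ∈ l.head?, G.Adj y x) :
    IsPathIn G t (y :: l) :=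
  ⟨List.isChain_cons.2 ⟨h, hl.chain⟩, List.nodup_cons.2 ⟨hyl, hl.nodup⟩,
    by simpa using ⟨hy, hl.mem⟩⟩

theorem IsPathIn.reverse {G : SimpleGraph V} {t : Finset V} {l : List V}
    (hl : IsPathIn G t l) : IsPathIn G t l.reverse :=
  ⟨by simpa [List.isChain_reverse, G.adj_comm] using hl.chain, by simpa using hl.nodup,
    by simpa using hl.mem⟩

theorem IsPathIn.hasPathOn {G : SimpleGraph V} {t : Finset V} {l : List V}
    (hl : IsPathIn G t l) (hne : l ≠ []) : HasPathOn G l.length := by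
  refine ⟨_, _, SimpleGraph.Walk.ofSupport l hne hl.chain, ?_, ?_⟩
  · rw [SimpleGraph.Walk.isPath_def, SimpleGraph.Walk.support_ofSupport]
    exact hl.nodup
  · rw [SimpleGraph.Walk.support_ofSupport]

theorem IsPathIn.exists_longer_of_closed {G : SimpleGraph V} {t : Finset V} {c : List V}
    (hc : IsPathIn G t c)
    (hclosed : ∀ x ∈ c.getLast?, ∀ y ∈ c.head?, x ≠ y → G.Adj x y)
    {z y : V} (hz : z ∈ c) (hy : y ∈ t) (hyc : y ∉ c) (hzy : G.Adj y z) :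
    ∃ l, IsPathIn G t l ∧ l.length = c.length + 1 := by
  obtain ⟨c₁, c₂, rfl⟩ := List.append_of_mem hz
  have hperm : (z :: c₂ ++ c₁).Perm (c₁ ++ z :: c₂) := List.perm_append_comm
  have hch := List.isChain_append.1 hc.chain
  have hrot : IsPathIn G t (z :: c₂ ++ c₁) := by
    refine ⟨List.isChain_append.2 ⟨hch.2.1, hch.1, ?_⟩, hperm.nodup_iff.2 hc.nodup,
      fun x hx => hc.mem x (hperm.mem_iff.1 hx)⟩
    intro x hx w hw
    have hxm := List.mem_of_getLast? hx
    have hwm := List.mem_of_head? hw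
    refine hclosed x ?_ w ?_ ?_
    · simpa [List.getLast?_append] using hx
    · cases c₁ <;> simp_all
    · rintro rfl
      exact List.disjoint_of_nodup_append hc.nodup hwm hxm
  refine ⟨y :: (z :: c₂ ++ c₁), hrot.cons hy (fun h => hyc (hperm.mem_iff.1 h)) ?_, ?_⟩
  · simpa using hzy
  · simp
    omega

/-- Given a vertex list whose endpoints have all their neighbours on the list and have degree sum at
least its order, there are consecutive vertices whose crossing chords close up a cycle. -/
theorem exists_crossing_chords {G : SimpleGraph V} {t : Finset V} {l : List V}
    (hne : l ≠ [])
    (hhead : ∀ y ∈ t, G.Adj (l.head hne) y → y ∈ l)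
    (hlast : ∀ y ∈ t, G.Adj (l.getLast hne) y → y ∈ l)
    (hdeg : l.length ≤ degIn G t (l.head hne) + degIn G t (l.getLast hne)) :
    ∃ (i : ℕ) (h : i + 1 < l.length),
      G.Adj (l.head hne) l[i + 1] ∧ G.Adj (l.getLast hne) l[i] := by
  classical
  by_contra! hno
  have hpos : 0 < l.length := List.length_pos_iff.2 hne
  let A := (t.filter (G.Adj (l.head hne))).image fun y => l.idxOf y - 1
  let B := (t.filter (G.Adj (l.getLast hne))).image fun y => l.idxOf y
  have hidx : ∀ y ∈ t, G.Adj (l.head hne) y → 0 < l.idxOf y := by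
    intro y hy hadj
    rw [Nat.pos_iff_ne_zero]
    intro h0
    have h1 := List.getElem_idxOf (List.idxOf_lt_length_of_mem (hhead y hy hadj))
    simp only [h0, List.getElem_zero] at h1
    exact hadj.ne h1
  have hidx' : ∀ y ∈ t, G.Adj (l.getLast hne) y → l.idxOf y < l.length - 1 := by
    intro y hy hadj
    have h2 := List.idxOf_lt_length_of_mem (hlast y hy hadj)
    refine lt_of_le_of_ne (by omega) fun h0 => ?_
    have h1 := List.getElem_idxOf h2
    simp only [h0] at h1
    rw [← List.getLast_eq_getElem hne] at h1
    exact hadj.ne h1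
  have hA : A.card = degIn G t (l.head hne) := by
    refine Finset.card_image_of_injOn fun x hx y hy hxy => ?_
    simp only [Finset.coe_filter, Set.mem_ofPred_eq] at hx hy
    have h1 := hidx x hx.1 hx.2
    have h2 := hidx y hy.1 hy.2
    refine (List.idxOf_inj (hhead x hx.1 hx.2)).1 ?_
    omega
  have hB : B.card = degIn G t (l.getLast hne) := by
    refine Finset.card_image_of_injOn fun x hx y hy hxy => ?_
    simp only [Finset.coe_filter, Set.mem_ofPred_eq] at hx hy
    exact (List.idxOf_inj (hlast x hx.1 hx.2)).1 hxy
  have hdisj : Disjoint A B := by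
    rw [Finset.disjoint_left]
    intro i hiA hiB
    obtain ⟨x, hx, rfl⟩ := Finset.mem_image.1 hiA
    obtain ⟨y, hy, hxy⟩ := Finset.mem_image.1 hiB
    rw [Finset.mem_filter] at hx hy
    have h1 := hidx x hx.1 hx.2
    have h2 := List.idxOf_lt_length_of_mem (hhead x hx.1 hx.2)
    have h3 := List.idxOf_lt_length_of_mem (hlast y hy.1 hy.2)
    have h4 : l.idxOf x = l.idxOf y + 1 := by omega
    have h5 : l[l.idxOf y + 1] = x := by
      simp only [← h4, List.getElem_idxOf]
    refine hno (l.idxOf y) (by omega) ?_ ?_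
    · rw [h5]; exact hx.2
    · rw [List.getElem_idxOf]; exact hy.2
  have hsub : A ∪ B ⊆ Finset.range (l.length - 1) := by
    intro i hi
    rw [Finset.mem_range]
    rcases Finset.mem_union.1 hi with hi | hi
    · obtain ⟨x, hx, rfl⟩ := Finset.mem_image.1 hi
      rw [Finset.mem_filter] at hx
      have h1 := hidx x hx.1 hx.2
      have h2 := List.idxOf_lt_length_of_mem (hhead x hx.1 hx.2)
      omega
    · obtain ⟨x, hx, rfl⟩ := Finset.mem_image.1 hi
      rw [Finset.mem_filter] at hx
      exact hidx' x hx.1 hx.2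
  have hcard := Finset.card_le_card hsub
  rw [Finset.card_union_of_disjoint hdisj, Finset.card_range] at hcard
  omega

theorem IsPathIn.exists_longer {G : SimpleGraph V} {t : Finset V} {d : ℕ}
    (hd : ∀ v ∈ t, d ≤ degIn G t v)
    (hconn : ∀ A ⊆ t, A.Nonempty → A ≠ t → ∃ a ∈ A, ∃ b ∈ t, b ∉ A ∧ G.Adj a b)
    {l : List V} (hl : IsPathIn G t l) (hne : l ≠ []) (hlt : l.length < t.card)
    (hld : l.length ≤ 2 * d) :
    ∃ l', IsPathIn G t l' ∧ l'.length = l.length + 1 := by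
  classical
  by_cases hhead : ∀ y ∈ t, G.Adj (l.head hne) y → y ∈ l
  swap
  · push Not at hhead
    obtain ⟨y, hy, hadj, hyl⟩ := hhead
    refine ⟨y :: l, hl.cons hy hyl fun x hx => ?_, by simp⟩
    rw [List.head?_eq_some_head hne, Option.mem_some_iff] at hx
    exact hx ▸ hadj.symm
  by_cases hlast : ∀ y ∈ t, G.Adj (l.getLast hne) y → y ∈ l
  swap
  · push Not at hlast
    obtain ⟨y, hy, hadj, hyl⟩ := hlast
    refine ⟨y :: l.reverse, hl.reverse.cons hy (by simpa using hyl) fun x hx => ?_, by simp⟩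
    rw [List.head?_reverse, List.getLast?_eq_some_getLast hne, Option.mem_some_iff] at hx
    exact hx ▸ hadj.symm
  have hdeg : l.length ≤ degIn G t (l.head hne) + degIn G t (l.getLast hne) := by
    have h1 := hd _ (hl.mem _ (l.head_mem hne))
    have h2 := hd _ (hl.mem _ (l.getLast_mem hne))
    omega
  obtain ⟨i, hi, hadj₁, hadj₂⟩ := exists_crossing_chords hne hhead hlast hdeg
  let c := (l.take (i + 1)).reverse ++ l.drop (i + 1)
  have hperm : c.Perm l := by
    simpa [c] using (List.reverse_perm (l.take (i + 1))).append_right (l.drop (i + 1))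
  have hsplit := hl.chain
  rw [← List.take_append_drop (i + 1) l, List.isChain_append] at hsplit
  have hc : IsPathIn G t c := by
    refine ⟨List.isChain_append.2 ⟨?_, hsplit.2.1, ?_⟩, hperm.nodup_iff.2 hl.nodup,
      fun x hx => hl.mem x (hperm.mem_iff.1 hx)⟩
    · simpa [List.isChain_reverse, G.adj_comm] using hsplit.1
    · intro x hx y hy
      rw [List.getLast?_reverse, List.head?_take, if_neg (by omega),
        List.head?_eq_some_head hne, Option.mem_some_iff] at hx
      rw [List.head?_drop, List.getElem?_eq_getElem hi, Option.mem_some_iff] at hy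
      subst hx hy
      exact hadj₁
  have hclosed : ∀ x ∈ c.getLast?, ∀ y ∈ c.head?, x ≠ y → G.Adj x y := by
    intro x hx y hy _
    have hx' : l.getLast hne = x := by
      have : c.getLast? = some (l.getLast hne) := by
        simp only [c, List.getLast?_append, List.getLast?_drop]
        rw [if_neg (by omega), List.getLast?_eq_some_getLast hne]
        simp
      rw [this, Option.mem_some_iff] at hx
      exact hx
    have hy' : l[i] = y := by
      have : c.head? = some l[i] := by
        simp only [c, List.head?_append, List.head?_reverse, List.getLast?_take]
        simp [List.getElem?_eq_getElem (show i < l.length by omega)]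
      rw [this, Option.mem_some_iff] at hy
      exact hy
    rw [← hx', ← hy']
    exact hadj₂
  obtain ⟨z, hz, y, hy, hyc, hzy⟩ := hconn c.toFinset
    (fun x hx => hc.mem x (by simpa using hx))
    ⟨l.head hne, by simpa using hperm.mem_iff.2 (l.head_mem hne)⟩
    (fun h => by
      have h1 := List.toFinset_card_le c
      rw [h, hperm.length_eq] at h1
      omega)
  obtain ⟨l', hl', hlen⟩ := hc.exists_longer_of_closed hclosed (List.mem_toFinset.1 hz) hy
    (fun h => hyc (List.mem_toFinset.2 h)) hzy.symm
  exact ⟨l', hl', by rw [hlen, hperm.length_eq]⟩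

/-- A connected graph of minimum degree at least `d` contains paths of every order up to
`min (|t|) (2 * d + 1)`. -/
theorem exists_isPathIn_of_le_degIn {G : SimpleGraph V} {t : Finset V} {d : ℕ}
    (hd : ∀ v ∈ t, d ≤ degIn G t v)
    (hconn : ∀ A ⊆ t, A.Nonempty → A ≠ t → ∃ a ∈ A, ∃ b ∈ t, b ∉ A ∧ G.Adj a b)
    (m : ℕ) (hmt : m ≤ t.card) (hmd : m ≤ 2 * d + 1) :
    ∃ l, IsPathIn G t l ∧ l.length = m := by
  induction m with
  | zero => exact ⟨[], ⟨by simp, by simp, by simp⟩, rfl⟩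
  | succ m ih =>
    obtain ⟨l, hl, rfl⟩ := ih (by omega) (by omega)
    rcases eq_or_ne l [] with rfl | hne
    · obtain ⟨v, hv⟩ := Finset.card_pos.1 (by omega : 0 < t.card)
      exact ⟨[v], ⟨by simp, by simp, by simpa using hv⟩, rfl⟩
    · exact hl.exists_longer hd hconn hne (by omega) (by omega)

theorem degIn_erase_add_one {G : SimpleGraph V} [DecidableEq V] {t : Finset V} {u v : V}
    (hu : u ∈ t) (h : G.Adj v u) : degIn G (t.erase u) v + 1 = degIn G t v := by
  classical
  unfold degIn
  rw [Finset.filter_erase, Finset.card_erase_add_one (by simp [hu, h])]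

theorem degIn_erase_of_not_adj {G : SimpleGraph V} [DecidableEq V] {t : Finset V} {u v : V}
    (h : ¬ G.Adj v u) : degIn G (t.erase u) v = degIn G t v := by
  classical
  unfold degIn
  rw [Finset.filter_erase, Finset.erase_eq_of_notMem (by simp [h])]

theorem degIn_le_card_sub_one {G : SimpleGraph V} {t : Finset V} {v : V} (hv : v ∈ t) :
    degIn G t v ≤ t.card - 1 := by
  classical
  rw [← Finset.card_erase_of_mem hv]
  refine Finset.card_le_card fun x hx => ?_
  rw [Finset.mem_filter] at hx
  exact Finset.mem_erase.2 ⟨hx.2.ne', hx.1⟩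

theorem degIn_eq_of_forall_adj {G : SimpleGraph V} {t : Finset V} {u : V} (hu : u ∈ t)
    (h : ∀ v, v ≠ u → G.Adj u v) : degIn G t u = t.card - 1 := by
  classical
  refine le_antisymm (degIn_le_card_sub_one hu) ?_
  rw [← Finset.card_erase_of_mem hu]
  refine Finset.card_le_card fun x hx => ?_
  rw [Finset.mem_erase] at hx
  exact Finset.mem_filter.2 ⟨hx.2, h x hx.1⟩

theorem degSum_le {G : SimpleGraph V} (t : Finset V) :
    degSum G t ≤ t.card * (t.card - 1) := by
  simpa [degSum] using Finset.sum_le_card_nsmul t _ _ fun v hv =>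
    degIn_le_card_sub_one (G := G) hv

theorem degSum_erase {G : SimpleGraph V} [DecidableEq V] {t : Finset V} {v : V} (hv : v ∈ t) :
    degSum G (t.erase v) + 2 * degIn G t v = degSum G t := by
  classical
  have h1 : ∀ w ∈ t.erase v, degIn G t w = degIn G (t.erase v) w + if G.Adj v w then 1 else 0 := by
    intro w _
    split_ifs with h
    · exact (degIn_erase_add_one hv h.symm).symm
    · rw [degIn_erase_of_not_adj fun h' => h h'.symm, add_zero]
  have h2 : degIn G (t.erase v) v = degIn G t v := degIn_erase_of_not_adj G.irrefl
  unfold degSum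
  rw [← Finset.add_sum_erase t _ hv, Finset.sum_congr rfl h1, Finset.sum_add_distrib,
    Finset.sum_boole, Nat.cast_id]
  change _ = _ + (_ + degIn G (t.erase v) v)
  rw [h2]
  ring

theorem exists_subset_le_degIn {G : SimpleGraph V} (u : V) (d : ℕ) (s : Finset V)
    (hu : u ∈ s) :
    ∃ t ⊆ s, u ∈ t ∧ (∀ v ∈ t, v ≠ u → d + 1 ≤ degIn G t v) ∧
      degSum G s + 2 * d * t.card ≤ degSum G t + 2 * d * s.card := by
  classical
  induction s using Finset.strongInduction with
  | H s ih =>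
    by_cases h : ∀ v ∈ s, v ≠ u → d + 1 ≤ degIn G s v
    · exact ⟨s, subset_rfl, hu, h, le_rfl⟩
    push Not at h
    obtain ⟨v, hv, hvu, hlt⟩ := h
    obtain ⟨t, hts, hut, ht, hsum⟩ :=
      ih (s.erase v) (Finset.erase_ssubset hv) (Finset.mem_erase.2 ⟨hvu.symm, hu⟩)
    refine ⟨t, hts.trans (Finset.erase_subset _ _), hut, ht, ?_⟩
    have h1 := degSum_erase (G := G) hv
    rw [← Finset.card_erase_add_one hv]
    nlinarith

theorem le_degIn_of_forall_ne {G : SimpleGraph V} {t : Finset V} {u : V} (hu : u ∈ t)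
    (h : ∀ v, v ≠ u → G.Adj u v) (hcard : 2 ≤ t.card) {d : ℕ}
    (ht : ∀ v ∈ t, v ≠ u → d ≤ degIn G t v) : ∀ v ∈ t, d ≤ degIn G t v := by
  intro v hv
  rcases eq_or_ne v u with rfl | hvu
  · obtain ⟨w, hw, hwv⟩ := Finset.exists_mem_ne hcard v
    rw [degIn_eq_of_forall_adj hu h]
    exact (ht w hw hwv).trans (degIn_le_card_sub_one hw)
  · exact ht v hv hvu

theorem exists_adj_not_mem_of_card_le {G : SimpleGraph V} {t : Finset V} {d : ℕ}
    (hd : ∀ v ∈ t, d ≤ degIn G t v) (hcard : t.card ≤ 2 * d + 1) :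
    ∀ A ⊆ t, A.Nonempty → A ≠ t → ∃ a ∈ A, ∃ b ∈ t, b ∉ A ∧ G.Adj a b := by
  classical
  have key : ∀ B ⊆ t, B.Nonempty → B.card ≤ d → ∃ a ∈ B, ∃ b ∈ t, b ∉ B ∧ G.Adj a b := by
    intro B hB ⟨a, ha⟩ hBd
    by_contra! hno
    have h1 : degIn G t a ≤ degIn G B a := by
      refine Finset.card_le_card fun x hx => ?_
      rw [Finset.mem_filter] at hx ⊢
      exact ⟨by_contra fun h => hno a ha x hx.1 h hx.2, hx.2⟩
    have h2 := degIn_le_card_sub_one (G := G) ha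
    have h3 := hd a (hB ha)
    have h4 := Finset.card_pos.2 ⟨a, ha⟩
    omega
  intro A hA hne hAt
  by_cases hAd : A.card ≤ d
  · exact key A hA hne hAd
  · have h1 := Finset.card_sdiff_add_card_eq_card hA
    obtain ⟨a, ha, b, hb, hba, hab⟩ := key (t \ A) Finset.sdiff_subset
      (Finset.sdiff_nonempty.2 fun h => hAt (hA.antisymm h)) (by omega)
    rw [Finset.mem_sdiff] at ha hba
    exact ⟨b, by_contra fun h => hba ⟨hb, h⟩, a, ha.1, ha.2, hab.symm⟩

theorem exists_adj_not_mem_of_forall_adj {G : SimpleGraph V} {t : Finset V} {u : V}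
    (hu : u ∈ t) (h : ∀ v, v ≠ u → G.Adj u v) :
    ∀ A ⊆ t, A.Nonempty → A ≠ t → ∃ a ∈ A, ∃ b ∈ t, b ∉ A ∧ G.Adj a b := by
  intro A hA ⟨a, ha⟩ hAt
  by_cases huA : u ∈ A
  · obtain ⟨b, hb, hbA⟩ := Finset.exists_of_ssubset (hA.ssubset_of_ne hAt)
    exact ⟨u, huA, b, hb, hbA, h b fun hbu => hbA (hbu ▸ huA)⟩
  · exact ⟨a, ha, u, hu, huA, (h a fun hau => huA (hau ▸ ha)).symm⟩

theorem hasPathOn_of_card_le {G : SimpleGraph V} [Fintype V] {t : Finset V} {u : V} {k : ℕ}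
    (hu : u ∈ t) (h : ∀ v, v ≠ u → G.Adj u v) (hd : ∀ v ∈ t, k + 1 ≤ degIn G t v)
    (hcard : 2 * k + 2 ≤ t.card) (hV : 2 * k + 3 ≤ Fintype.card V) :
    HasPathOn G (2 * k + 3) := by
  classical
  rcases hcard.lt_or_eq with hlt | heq
  · obtain ⟨l, hl, hlen⟩ := exists_isPathIn_of_le_degIn hd
      (exists_adj_not_mem_of_forall_adj hu h) (2 * k + 3) (by omega) (by omega)
    exact hlen ▸ hl.hasPathOn (List.ne_nil_of_length_pos (by omega))
  · have hec : (t.erase u).card = 2 * k + 1 := by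
      rw [Finset.card_erase_of_mem hu, ← heq]
      omega
    have hd' : ∀ v ∈ t.erase u, k ≤ degIn G (t.erase u) v := by
      intro v hv
      have h1 := hd v (Finset.mem_of_mem_erase hv)
      rw [← degIn_erase_add_one hu (h v (Finset.ne_of_mem_erase hv)).symm] at h1
      omega
    obtain ⟨l, hl, hlen⟩ := exists_isPathIn_of_le_degIn hd'
      (exists_adj_not_mem_of_card_le hd' hec.le) (2 * k + 1) hec.ge le_rfl
    obtain ⟨w, hw⟩ : ∃ w, w ∉ t := by
      by_contra! hall
      have := Finset.card_le_card (fun x _ => hall x : Finset.univ ⊆ t)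
      rw [Finset.card_univ] at this
      omega
    have hl' : IsPathIn G Finset.univ l := ⟨hl.chain, hl.nodup, by simp⟩
    have hul : u ∉ l := fun hm => by simpa using hl.mem u hm
    have hwu : w ≠ u := fun hwu => hw (hwu ▸ hu)
    have hp := (hl'.cons (Finset.mem_univ u) hul fun x hx =>
      h x fun hxu => hul (hxu ▸ List.mem_of_head? hx)).cons (y := w) (Finset.mem_univ w)
      (by
        rw [List.mem_cons, not_or]
        exact ⟨hwu, fun hm => hw (Finset.mem_of_mem_erase (hl.mem w hm))⟩)
      (by simpa using (h w hwu).symm)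
    simpa [hlen] using hp.hasPathOn (by simp)

theorem deg_induce {G : SimpleGraph V} (s : Finset V) (v : (s : Set V)) :
    deg (G.induce (s : Set V)) v = degIn G s v := by
  classical
  unfold deg degIn
  rw [← Set.ncard_coe_finset, ← Nat.card_coe_set_eq]
  refine Nat.card_congr ⟨fun x => ⟨x.1.1, ?_⟩, fun x => ⟨⟨x.1, ?_⟩, ?_⟩, ?_, ?_⟩
  · exact Finset.mem_filter.2 ⟨x.1.2, x.2⟩
  · exact (Finset.mem_filter.1 x.2).1
  · exact (Finset.mem_filter.1 x.2).2
  · exact fun _ => rfl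
  · exact fun _ => rfl

theorem degSum_univ [Fintype V] (G : SimpleGraph V) :
    degSum G Finset.univ = 2 * edgeCount G := by
  classical
  unfold edgeCount
  rw [Nat.card_eq_fintype_card, ← SimpleGraph.edgeFinset_card,
    ← SimpleGraph.sum_degrees_eq_twice_card_edges]
  refine Finset.sum_congr rfl fun v _ => ?_
  unfold degIn
  rw [← SimpleGraph.neighborFinset_eq_filter, SimpleGraph.card_neighborFinset_eq_degree]

theorem forall_adj_of_deg_eq [Fintype V] {G : SimpleGraph V} {u : V}
    (hu : deg G u = Fintype.card V - 1) : ∀ v, v ≠ u → G.Adj u v := by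
  classical
  unfold deg at hu
  rw [Nat.card_eq_fintype_card, SimpleGraph.card_neighborSet_eq_degree] at hu
  intro v hv
  exact ((G.degree_eq_card_sub_one u).1 hu) hv.symm

end PathLemmas

/-- If `k ≥ 2`, `n ≥ 7k²`, `e(G) > k(n-k)`, `δ(G) ≤ k-1`, `G` has a dominating
vertex `u` and no path on `2k+3` vertices, then `G` has an induced subgraph `H`
on at least `n - k²` vertices with `δ(H) ≥ k` and `u ∈ V(H)`. -/
theorem stmt_5 (k n : ℕ) (hk : 2 ≤ k) (hn : 7 * k ^ 2 ≤ n) (G : SimpleGraph (Fin n))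
    (he : k * (n - k) < edgeCount G) (hδ : ∃ v, deg G v ≤ k - 1)
    (u : Fin n) (hu : deg G u = n - 1) (hP : ¬ HasPathOn G (2 * k + 3)) :
    ∃ s : Finset (Fin n), u ∈ s ∧ n - k ^ 2 ≤ s.card ∧
      ∀ v : (s : Set (Fin n)), k ≤ deg (G.induce (s : Set (Fin n))) v := by
  have hadj := forall_adj_of_deg_eq (G := G) (u := u) (by rwa [Fintype.card_fin])
  have hkn : 2 * k + 3 ≤ n := by nlinarith
  obtain ⟨j, rfl⟩ : ∃ j, k = j + 1 := ⟨k - 1, by omega⟩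
  obtain ⟨s, -, hus, hs, hsum⟩ := exists_subset_le_degIn (G := G) u j _ (Finset.mem_univ u)
  rw [degSum_univ, Finset.card_univ, Fintype.card_fin] at hsum
  have hcard : n - (j + 1) ^ 2 ≤ s.card := by
    by_contra! hlt
    obtain ⟨t, hts, hut, ht, hsum'⟩ := exists_subset_le_degIn (G := G) u (j + 1) s hus
    have hle := degSum_le (G := G) t
    have hgt : 2 * (j + 1) * t.card < t.card * (t.card - 1) := by
      have h1 : s.card + (j + 1) ^ 2 < n := by omega
      zify [show j + 1 ≤ n by omega] at he hsum hsum' h1 ⊢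
      zify at hle
      nlinarith
    have htc : 2 * (j + 1) + 2 ≤ t.card := by
      have : 2 * (j + 1) < t.card - 1 := by
        rw [mul_comm] at hgt
        exact lt_of_mul_lt_mul_left hgt (Nat.zero_le _)
      omega
    exact hP (hasPathOn_of_card_le hut hadj (le_degIn_of_forall_ne hut hadj (by omega) ht)
      htc (by rwa [Fintype.card_fin]))
  have h2 : 2 ≤ s.card := by
    have : 2 + (j + 1) ^ 2 ≤ n := by nlinarith
    omega
  refine ⟨s, hus, hcard, fun v => ?_⟩
  rw [deg_induce]
  exact le_degIn_of_forall_ne hus hadj h2 hs v v.2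
end
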